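/- Let n be a prime or the square of a prime. Then there exist finitely many matrices g_1, …, g_k in SL(2,ℤ) such that: (i) the lower-left entry of each g_i equals n; (ii) |tr g_i| ≤ n − 2 and ‖g_i‖_F < 2n − 1 for each i; and (iii) the image of Γ₀(n) in PSL(2,ℤ) is the free product of the cyclic subgroups generated by the images of g_1, …, g_k together with the infinite cyclic subgroup generated by T, i.e. the natural homomorphism from the abstract free product ⟨g_1⟩ ∗ ⋯ ∗ ⟨g_k⟩ ∗ ⟨T⟩ of these cyclic groups to PSL(2,ℤ) is injective with image Γ₀(n). -/

import Mathlib

open Matrix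

/-- `SL(2, ℤ)`. -/
abbrev SL2Z := Matrix.SpecialLinearGroup (Fin 2) ℤ

/-- `PSL(2, ℤ)`, the quotient of `SL(2, ℤ)` by its center. -/
abbrev PSL2Z := SL2Z ⧸ Subgroup.center SL2Z

/-- The natural projection `SL(2, ℤ) → PSL(2, ℤ)`. -/
def projPSL : SL2Z →* PSL2Z := QuotientGroup.mk' (Subgroup.center SL2Z)


lemma elim_aux {α : Type} [Finite α] (σ ρ : α → α) (U : Set α) (hσ : ∀ x, σ (σ x) = x)
    (hρ : ∀ x ∈ U, ρ x ∈ U) (hρ3 : ∀ x ∈ U, ρ (ρ (ρ x)) = x)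
    (hconn : ∀ B ⊆ U, (∀ x ∈ B, ρ x ∈ B) → (∀ x ∈ B, σ x ∈ B) → B = ∅) :
    ∃ K : Set α, (∀ x ∈ K, σ x ∈ K) ∧
      (∀ (G : Type) [Group G] (f : α → G), (∀ x, f x * f (σ x) = 1) →
        (∀ x ∈ U, ρ x = x → f x ^ 3 = 1) →
        ∃ γ : α → G, (∀ x ∈ K, γ x = f x) ∧ (∀ x, γ x * γ (σ x) = 1) ∧
          ∀ x ∈ U, γ x * γ (ρ x) * γ (ρ (ρ x)) = 1) ∧
      (∀ (G : Type) [Group G] (γ : α → G) (L : Subgroup G), (∀ x, γ x * γ (σ x) = 1) →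
        (∀ x ∈ U, γ x * γ (ρ x) * γ (ρ (ρ x)) = 1) → (∀ x ∈ K, γ x ∈ L) → ∀ x, γ x ∈ L) := by
  classical
  let P : Set α → Prop := fun A => A ⊆ U ∧ (∀ x ∈ A, ρ x ∈ A) ∧
    (∀ x ∈ A, ρ x = x → σ x ∈ A ∨ σ x ∉ U) ∧
    ∃ K : Set α, (∀ x ∈ K, σ x ∈ K) ∧ (∀ x ∈ U, x ∉ A → x ∈ K) ∧
      (∀ (G : Type) [Group G] (f : α → G), (∀ x, f x * f (σ x) = 1) →
        (∀ x ∈ U, ρ x = x → f x ^ 3 = 1) →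
        ∃ γ : α → G, (∀ x ∈ K, γ x = f x) ∧ (∀ x, γ x * γ (σ x) = 1) ∧
          ∀ x ∈ A, γ x * γ (ρ x) * γ (ρ (ρ x)) = 1) ∧
      (∀ (G : Type) [Group G] (γ : α → G) (L : Subgroup G), (∀ x, γ x * γ (σ x) = 1) →
        (∀ x ∈ U, γ x * γ (ρ x) * γ (ρ (ρ x)) = 1) → (∀ x ∈ K, γ x ∈ L) → ∀ x, γ x ∈ L)
  have h0 : P ∅ := by
    refine ⟨by simp, by simp, by simp, Set.univ, by simp, by simp, ?_, ?_⟩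
    · intro G _ f h1 _
      exact ⟨f, by simp, h1, by simp⟩
    · intro G _ γ L _ _ h x
      exact h x trivial
  obtain ⟨A, hA⟩ := (Set.toFinite {A | P A}).exists_maximal ⟨∅, h0⟩
  have hmax : ∀ A', P A' → A ⊆ A' → A' ⊆ A := fun A' h1 h2 => hA.2 h1 h2
  obtain ⟨hAU, hAρ, hAe, K, hKσ, hKB, hK1, hK2⟩ := hA.1
  have hρB : ∀ x ∈ U, x ∉ A → ρ x ∉ A := by
    intro x hx hxA h
    apply hxA
    have := hAρ _ (hAρ _ h)
    rwa [hρ3 x hx] at this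
  by_cases hall : A = U
  · subst hall
    exact ⟨K, hKσ, hK1, hK2⟩
  exfalso
  have hex : ∃ x, x ∈ U ∧ x ∉ A ∧ (σ x ∈ A ∨ σ x ∉ U) := by
    by_contra! hno
    have := hconn (U \ A) Set.sdiff_subset (fun x hx => ⟨hρ x hx.1, hρB x hx.1 hx.2⟩)
      (fun x hx => ⟨(hno x hx.1 hx.2).2, (hno x hx.1 hx.2).1⟩)
    exact hall (Set.Subset.antisymm hAU (Set.sdiff_eq_empty.1 this))
  obtain ⟨x, hxU, hxA, hσx⟩ := hex
  have hσxB : ∀ y ∈ U, y ∉ A → y ≠ σ x := by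
    rintro y h1 h2 rfl
    tauto
  have hyU := hρ x hxU
  have hyA := hρB x hxU hxA
  have hzU := hρ _ hyU
  have hzA := hρB _ hyU hyA
  have hx3 := hρ3 x hxU
  have key : ∀ K' : Set α, (∀ x ∈ K', σ x ∈ K') → (∀ y ∈ U, y ∉ A → y ≠ x → y ≠ ρ x → y ≠ ρ (ρ x) → y ∈ K') →
     (∀ (G : Type) [Group G] (f : α → G), (∀ x, f x * f (σ x) = 1) →
        (∀ x ∈ U, ρ x = x → f x ^ 3 = 1) →
        ∃ γ : α → G, (∀ x ∈ K', γ x = f x) ∧ (∀ x, γ x * γ (σ x) = 1) ∧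
          (∀ x ∈ A, γ x * γ (ρ x) * γ (ρ (ρ x)) = 1) ∧  γ x * γ (ρ x) * γ (ρ (ρ x)) = 1) →
      (∀ (G : Type) [Group G] (γ : α → G) (L : Subgroup G), (∀ x, γ x * γ (σ x) = 1) →
        (∀ x ∈ U, γ x * γ (ρ x) * γ (ρ (ρ x)) = 1) → (∀ x ∈ K', γ x ∈ L) → ∀ x, γ x ∈ L) →
      False := by
    intro K' k1 k2 k3 k4
    have hP : P (A ∪ {x, ρ x, ρ (ρ x)}) := by
      refine ⟨?_, ?_, ?_, K', k1, ?_, ?_, k4⟩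
      · intro y hy
        simp only [Set.mem_union, Set.mem_insert_iff, Set.mem_singleton_iff] at hy
        rcases hy with h | rfl | rfl | rfl
        exacts [hAU h, hxU, hyU, hzU]
      · intro y hy
        simp only [Set.mem_union, Set.mem_insert_iff, Set.mem_singleton_iff] at hy ⊢
        rcases hy with h | rfl | rfl | rfl
        · exact Or.inl (hAρ y h)
        · simp
        · simp
        · simp [hx3]
      · have hh : ρ x = x → σ x ∈ A ∪ {x, ρ x, ρ (ρ x)} ∨ σ x ∉ U := fun _ =>
          hσx.imp (fun h => Or.inl h) id
        intro y hy hye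
        simp only [Set.mem_union, Set.mem_insert_iff, Set.mem_singleton_iff] at hy
        rcases hy with h | rfl | rfl | rfl
        · exact (hAe y h hye).imp (fun h => Or.inl h) id
        · exact hh hye
        · have h1 : ρ x = x := by rw [← hx3, hye, hye, ← hye]; simp [hye]
          simpa [h1] using hh h1
        · have h1 : ρ x = x := by
            have : ρ (ρ x) = x := by rw [← hye, hx3]
            rw [this] at hye; exact hye
          simpa [h1] using hh h1
      · intro y hy hyn
        simp only [Set.mem_union, Set.mem_insert_iff, Set.mem_singleton_iff] at hyn
        push Not at hyn
        exact k2 y hy hyn.1 hyn.2.1 hyn.2.2.1 hyn.2.2.2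
      · intro G _ f f1 f2
        obtain ⟨γ, g1, g2, g3, g4⟩ := k3 G f f1 f2
        refine ⟨γ, g1, g2, ?_⟩
        intro y hy
        simp only [Set.mem_union, Set.mem_insert_iff, Set.mem_singleton_iff] at hy
        rcases hy with h | rfl | rfl | rfl
        · exact g3 y h
        · exact g4
        · rw [hx3]
          rw [mul_assoc] at g4
          exact mul_eq_one_comm.1 g4
        · rw [hx3]
          have := mul_eq_one_comm.1 g4
          rwa [← mul_assoc] at this
    exact hxA (hmax _ hP Set.subset_union_left (Or.inr (by simp)))
  by_cases hell : ρ x = x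
  · refine key K hKσ (fun y h1 h2 _ _ _ => hKB y h1 h2) ?_ hK2
    intro G _ f f1 f2
    obtain ⟨γ, g1, g2, g3⟩ := hK1 G f f1 f2
    refine ⟨γ, g1, g2, g3, ?_⟩
    rw [hell, hell, g1 x (hKB x hxU hxA), ← f2 x hxU hell, pow_three']
  · refine key (K \ {x, σ x}) ?_ ?_ ?_ ?_
    · rintro y ⟨hy, hy2⟩
      refine ⟨hKσ y hy, ?_⟩
      simp only [Set.mem_insert_iff, Set.mem_singleton_iff] at hy2 ⊢
      rintro (h | h)
      · exact hy2 (Or.inr (by rw [← h, hσ]))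
      · exact hy2 (Or.inl (by rw [← hσ y, h, hσ]))
    · intro y h1 h2 h3 _ _
      refine ⟨hKB y h1 h2, ?_⟩
      simp only [Set.mem_insert_iff, Set.mem_singleton_iff]
      exact fun h => h.elim h3 (hσxB y h1 h2)
    · intro G _ f f1 f2
      have hyx : ρ x ≠ x := hell
      have hzx : ρ (ρ x) ≠ x := fun h => hell (by rw [h] at hx3; exact hx3)
      have hxs := hσxB x hxU hxA
      let f' : α → G := fun y => if y = x then (f (ρ x) * f (ρ (ρ x)))⁻¹ else
        if y = σ x then f (ρ x) * f (ρ (ρ x)) else f y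
      have e1 : f' x = (f (ρ x) * f (ρ (ρ x)))⁻¹ := by simp [f']
      have e2 : f' (σ x) = f (ρ x) * f (ρ (ρ x)) := by simp [f', hxs.symm]
      have e3 : ∀ y, y ≠ x → y ≠ σ x → f' y = f y := by
        intro y h1 h2; simp [f', h1, h2]
      have c1 : ∀ y, f' y * f' (σ y) = 1 := by
        intro y
        by_cases h1 : y = x
        · subst h1; rw [e1, e2]; group
        by_cases h2 : y = σ x
        · subst h2; rw [hσ, e1, e2]; group
        rw [e3 y h1 h2, e3 (σ y), f1]
        · intro h; exact h2 (by rw [← h, hσ])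
        · intro h; exact h1 (by rw [← hσ y, h, hσ])
      have c2 : ∀ y ∈ U, ρ y = y → f' y ^ 3 = 1 := by
        intro y hy hye
        by_cases h1 : y = x
        · subst h1; exact absurd hye hell
        by_cases h2 : y = σ x
        · subst h2
          rcases hσx with h | h
          · have := hAe _ h hye
            rw [hσ] at this
            tauto
          · exact absurd hy h
        rw [e3 y h1 h2, f2 y hy hye]
      obtain ⟨γ, g1, g2, g3⟩ := hK1 G f' c1 c2
      refine ⟨γ, ?_, g2, g3, ?_⟩
      · rintro y ⟨hy, hy2⟩
        simp only [Set.mem_insert_iff, Set.mem_singleton_iff, not_or] at hy2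
        rw [g1 y hy, e3 y hy2.1 hy2.2]
      · rw [g1 _ (hKB x hxU hxA), g1 _ (hKB _ hyU hyA), g1 _ (hKB _ hzU hzA), e1,
          e3 _ hyx (hσxB _ hyU hyA), e3 _ hzx (hσxB _ hzU hzA)]
        group
    · intro G _ γ L g1 g2 g3
      apply hK2 G γ L g1 g2
      have hyx : ρ x ≠ x := hell
      have hzx : ρ (ρ x) ≠ x := fun h => hell (by rw [h] at hx3; exact hx3)
      have m1 : γ (ρ x) ∈ L := g3 _ ⟨hKB _ hyU hyA, by
        simp only [Set.mem_insert_iff, Set.mem_singleton_iff, not_or]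
        exact ⟨hyx, hσxB _ hyU hyA⟩⟩
      have m2 : γ (ρ (ρ x)) ∈ L := g3 _ ⟨hKB _ hzU hzA, by
        simp only [Set.mem_insert_iff, Set.mem_singleton_iff, not_or]
        exact ⟨hzx, hσxB _ hzU hzA⟩⟩
      have m3 : γ x ∈ L := by
        have h := g2 x hxU
        rw [mul_assoc] at h
        rw [eq_inv_of_mul_eq_one_left h]
        exact L.inv_mem (L.mul_mem m1 m2)
      have m4 : γ (σ x) ∈ L := by
        rw [eq_inv_of_mul_eq_one_right (g1 x)]
        exact L.inv_mem m3
      intro y hy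
      by_cases h1 : y = x
      · subst h1; exact m3
      by_cases h2 : y = σ x
      · subst h2; exact m4
      exact g3 y ⟨hy, by simp [h1, h2]⟩

lemma sl_mul (A B : SL2Z) (i j : Fin 2) : (A * B) i j = A i 0 * B 0 j + A i 1 * B 1 j := by
  rw [Matrix.SpecialLinearGroup.coe_mul, Matrix.mul_apply, Fin.sum_univ_two]

lemma sl_inv00 (A : SL2Z) : A⁻¹ 0 0 = A 1 1 := by
  simp [Matrix.SpecialLinearGroup.coe_inv, Matrix.adjugate_fin_two]

lemma sl_inv01 (A : SL2Z) : A⁻¹ 0 1 = -A 0 1 := by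
  simp [Matrix.SpecialLinearGroup.coe_inv, Matrix.adjugate_fin_two]

lemma sl_inv10 (A : SL2Z) : A⁻¹ 1 0 = -A 1 0 := by
  simp [Matrix.SpecialLinearGroup.coe_inv, Matrix.adjugate_fin_two]

lemma sl_inv11 (A : SL2Z) : A⁻¹ 1 1 = A 0 0 := by
  simp [Matrix.SpecialLinearGroup.coe_inv, Matrix.adjugate_fin_two]

lemma mem_center_SL2Z (A : SL2Z) : A ∈ Subgroup.center SL2Z ↔ A = 1 ∨ A = -1 := by
  rw [Matrix.SpecialLinearGroup.mem_center_iff]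
  constructor
  · rintro ⟨r, hr, h⟩
    have : r = 1 ∨ r = -1 := by
      rw [Fintype.card_fin] at hr
      exact sq_eq_one_iff.1 hr
    rcases this with rfl | rfl
    · left; ext i j; simp [← h]
    · right; ext i j; simp [← h]
  · rintro (rfl | rfl)
    · exact ⟨1, by simp, by simp⟩
    · exact ⟨-1, by simp, by simp⟩

lemma projPSL_eq_one (A : SL2Z) : projPSL A = 1 ↔ A = 1 ∨ A = -1 := by
  rw [← mem_center_SL2Z]
  exact QuotientGroup.eq_one_iff A

lemma projPSL_eq (A B : SL2Z) : projPSL A = projPSL B ↔ A = B ∨ A = -B := by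
  rw [← div_eq_one, ← map_div, projPSL_eq_one, div_eq_one, div_eq_iff_eq_mul]
  simp

lemma projPSL_surj : Function.Surjective projPSL := QuotientGroup.mk'_surjective _

def posSet (e : ℤ) : Set PSL2Z := {g | ∃ M : SL2Z, projPSL M = g ∧ 0 < e * (M 0 0 * M 1 0)}

lemma posSet_iff (e : ℤ) (M : SL2Z) : projPSL M ∈ posSet e ↔ 0 < e * (M 0 0 * M 1 0) := by
  constructor
  · rintro ⟨N, h, hN⟩
    rcases (projPSL_eq _ _).1 h with rfl | rfl
    · exact hN
    · simpa using hN
  · intro h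
    exact ⟨M, rfl, h⟩

def sbar : PSL2Z := projPSL ModularGroup.S
def ubar : PSL2Z := projPSL (ModularGroup.T * ModularGroup.S)

lemma sbar2 : sbar ^ 2 = 1 := by
  rw [sbar, ← map_pow, projPSL_eq_one]
  decide

lemma ubar3 : ubar ^ 3 = 1 := by
  rw [ubar, ← map_pow, projPSL_eq_one]
  decide

/-- Orders of the two free factors. -/
def ord23 : Fin 2 → ℕ := ![2, 3]

/-- A hom from a cyclic group from an element. -/
def zhom {G : Type} [Group G] (m : ℕ) (g : G) (h : g ^ m = 1) : Multiplicative (ZMod m) →* G :=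
  AddMonoidHom.toMultiplicativeLeft (ZMod.lift m ⟨(zmultiplesHom (Additive G)) (Additive.ofMul g), by
    simpa [← ofMul_pow] using congrArg Additive.ofMul h⟩)

lemma zhom_one {G : Type} [Group G] (m : ℕ) (g : G) (h : g ^ m = 1) :
    zhom m g h (Multiplicative.ofAdd 1) = g := by
  have : (1 : ZMod m) = ((1 : ℤ) : ZMod m) := by simp
  rw [this]
  unfold zhom
  rw [AddMonoidHom.coe_toMultiplicativeLeft]
  simp only [Function.comp_apply, toAdd_ofAdd, ZMod.lift_coe]
  simp

lemma pp_inj : Function.Injective (Monoid.CoprodI.lift (fun i : Fin 2 =>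
    zhom (ord23 i) ((![sbar, ubar] : Fin 2 → PSL2Z) i)
      (by fin_cases i; exacts [sbar2, ubar3]))) := by
  apply Monoid.CoprodI.lift_injective_of_ping_pong _ _ (fun i : Fin 2 => posSet (![-1, 1] i))
  · intro i
    fin_cases i
    · refine ⟨projPSL (ModularGroup.S * ModularGroup.T * ModularGroup.S), (posSet_iff _ _).2 ?_⟩
      decide
    · refine ⟨projPSL (ModularGroup.T * ModularGroup.S * ModularGroup.T⁻¹), (posSet_iff _ _).2 ?_⟩
      decide
  · intro i j hij
    rw [Function.onFun, Set.disjoint_left]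
    intro a ha hb
    obtain ⟨M, rfl⟩ := projPSL_surj a
    rw [posSet_iff] at ha hb
    fin_cases i <;> fin_cases j <;> simp at hij ha hb <;> linarith
  · intro i j hij h hh
    rintro _ ⟨a, ha, rfl⟩
    obtain ⟨M, rfl⟩ := projPSL_surj a
    dsimp only at ha ⊢
    fin_cases i <;> fin_cases j
    · simp at hij
    · have h1 : h = Multiplicative.ofAdd 1 := by
        revert hh
        exact (by decide : ∀ h : ZMod 2, h ≠ 0 → h = 1) h
      rw [h1, zhom_one]
      change sbar * projPSL M ∈ posSet (-1)
      rw [posSet_iff] at ha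
      rw [sbar, ← map_mul, posSet_iff]
      simp [sl_mul, ModularGroup.coe_S] at ha ⊢
      linarith
    · have h1 : h = Multiplicative.ofAdd 1 ∨ h = (Multiplicative.ofAdd 1)⁻¹ := by
        revert hh
        exact (by decide : ∀ h : ZMod 3, h ≠ 0 → h = 1 ∨ h = -1) h
      rw [posSet_iff] at ha
      rcases h1 with h1 | h1
      · rw [h1, zhom_one]
        change ubar * projPSL M ∈ posSet 1
        rw [ubar, ← map_mul, posSet_iff]
        simp [sl_mul, ModularGroup.coe_S, ModularGroup.coe_T] at ha ⊢
        nlinarith [sq_nonneg (M 0 0)]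
      · rw [h1, map_inv, zhom_one]
        change ubar⁻¹ * projPSL M ∈ posSet 1
        rw [ubar, ← map_inv, ← map_mul, posSet_iff]
        rw [sl_mul, sl_mul, sl_inv00, sl_inv01, sl_inv10, sl_inv11]
        simp [sl_mul, ModularGroup.coe_S, ModularGroup.coe_T] at ha ⊢
        nlinarith [sq_nonneg (M 1 0)]
    · simp at hij
  · right
    refine ⟨1, ?_⟩
    simp [ord23]


lemma exists_hom {G : Type} [Group G] (s u : G) (hs : s ^ 2 = 1) (hu : u ^ 3 = 1) :
    ∃ φ : PSL2Z →* G, φ (projPSL ModularGroup.S) = s ∧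
      φ (projPSL (ModularGroup.T * ModularGroup.S)) = u := by
  have hinj := pp_inj
  set F := Monoid.CoprodI.lift (fun i : Fin 2 =>
    zhom (ord23 i) ((![sbar, ubar] : Fin 2 → PSL2Z) i)
      (by fin_cases i; exacts [sbar2, ubar3])) with hF
  let s0 : Monoid.CoprodI (fun i : Fin 2 => Multiplicative (ZMod (ord23 i))) :=
    Monoid.CoprodI.of (i := 0) (Multiplicative.ofAdd 1)
  let u0 : Monoid.CoprodI (fun i : Fin 2 => Multiplicative (ZMod (ord23 i))) :=
    Monoid.CoprodI.of (i := 1) (Multiplicative.ofAdd 1)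
  have h1 : F s0 = projPSL ModularGroup.S := by
    rw [hF, Monoid.CoprodI.lift_of, zhom_one]; rfl
  have h2 : F u0 = projPSL (ModularGroup.T * ModularGroup.S) := by
    rw [hF, Monoid.CoprodI.lift_of, zhom_one]; rfl
  have hsurj : Function.Surjective F := by
    rw [← MonoidHom.range_eq_top, eq_top_iff]
    have h3 : Subgroup.map projPSL (Subgroup.closure {ModularGroup.S, ModularGroup.T}) = ⊤ := by
      rw [SpecialLinearGroup.SL2Z_generators, ← MonoidHom.range_eq_map]
      exact MonoidHom.range_eq_top.2 projPSL_surj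
    rw [← h3, MonoidHom.map_closure, Subgroup.closure_le]
    rintro _ ⟨x, hx, rfl⟩
    rcases hx with rfl | rfl
    · exact ⟨s0, h1⟩
    · refine ⟨u0 * s0⁻¹, ?_⟩
      rw [map_mul, map_inv, h1, h2, map_mul, mul_inv_cancel_right]
  let e := MulEquiv.ofBijective F ⟨hinj, hsurj⟩
  let Ψ : Monoid.CoprodI (fun i : Fin 2 => Multiplicative (ZMod (ord23 i))) →* G :=
    Monoid.CoprodI.lift (fun i : Fin 2 =>
    zhom (ord23 i) ((![s, u] : Fin 2 → G) i) (by fin_cases i; exacts [hs, hu]))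
  have h1' : e.symm (projPSL ModularGroup.S) = s0 := by
    rw [MulEquiv.symm_apply_eq]; exact h1.symm
  have h2' : e.symm (projPSL (ModularGroup.T * ModularGroup.S)) = u0 := by
    rw [MulEquiv.symm_apply_eq]; exact h2.symm
  refine ⟨Ψ.comp e.symm.toMonoidHom, ?_, ?_⟩
  · change Ψ (e.symm _) = s
    rw [h1', Monoid.CoprodI.lift_of, zhom_one]; rfl
  · change Ψ (e.symm _) = u
    rw [h2', Monoid.CoprodI.lift_of, zhom_one]; rfl

/-- The involution `x ↦ -1/x` on units. -/
def sg {n : ℕ} (x : (ZMod n)ˣ) : (ZMod n)ˣ := -x⁻¹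

open Classical in
/-- The partial order-three map `x ↦ 1 - 1/x`. -/
noncomputable def rho {n : ℕ} (x : (ZMod n)ˣ) : (ZMod n)ˣ :=
  if h : IsUnit ((x : ZMod n) - 1) then h.unit * x⁻¹ else x

/-- The domain of `rho`. -/
def Ud (n : ℕ) : Set (ZMod n)ˣ := {x | IsUnit ((x : ZMod n) - 1)}

lemma sg_sg {n : ℕ} (x : (ZMod n)ˣ) : sg (sg x) = x := by simp [sg]

lemma sg_mul {n : ℕ} (x : (ZMod n)ˣ) : (sg x : ZMod n) * x = -1 := by simp [sg]

lemma sg_unique {n : ℕ} (x : (ZMod n)ˣ) (k : ZMod n) (h : k * x = -1) : (sg x : ZMod n) = k := by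
  have h2 := sg_mul x
  rw [← h] at h2
  exact x.isUnit.mul_right_cancel h2

lemma rho_eq {n : ℕ} {x : (ZMod n)ˣ} (h : x ∈ Ud n) : (rho x : ZMod n) = sg x + 1 := by
  have h' : IsUnit ((x : ZMod n) - 1) := h
  simp only [rho, dif_pos h', Units.val_mul, IsUnit.unit_spec, sg, Units.val_neg]
  rw [sub_mul]
  simp
  ring

lemma rho_mem {n : ℕ} {x : (ZMod n)ˣ} (h : x ∈ Ud n) : rho x ∈ Ud n := by
  change IsUnit _
  rw [rho_eq h]
  simp

lemma rho3 {n : ℕ} {x : (ZMod n)ˣ} (h : x ∈ Ud n) : rho (rho (rho x)) = x := by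
  have key : ∀ y ∈ Ud n, (rho y : ZMod n) * y = y - 1 := by
    intro y hy
    rw [rho_eq hy, add_mul, sg_mul]; ring
  have h1 := key _ h
  have h2 := key _ (rho_mem h)
  have h3 := key _ (rho_mem (rho_mem h))
  ext
  set a := (x : ZMod n)
  set b := (rho x : ZMod n)
  set c := (rho (rho x) : ZMod n)
  set e := (rho (rho (rho x)) : ZMod n)
  linear_combination (-b * a) * h3 + (e * a - a) * h2 + e * h1

lemma conn {n : ℕ} (hn : 1 < n) (B : Set (ZMod n)ˣ) (hB : B ⊆ Ud n) (h1 : ∀ x ∈ B, rho x ∈ B)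
    (h2 : ∀ x ∈ B, sg x ∈ B) : B = ∅ := by
  have : Fact (1 < n) := ⟨hn⟩
  by_contra hne
  obtain ⟨x, hx⟩ := Set.nonempty_iff_ne_empty.2 hne
  have step : ∀ y ∈ B, ∃ z ∈ B, (z : ZMod n) = y - 1 := by
    intro y hy
    refine ⟨_, h2 _ (h1 _ (h1 _ hy)), ?_⟩
    have := rho_eq (rho_mem (rho_mem (hB hy)))
    rw [rho3 (hB hy)] at this
    rw [this]; ring
  have all : ∀ m : ℕ, ∃ z ∈ B, (z : ZMod n) = x - m := by
    intro m
    induction m with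
    | zero => exact ⟨x, hx, by simp⟩
    | succ m ih =>
      obtain ⟨z, hz, e⟩ := ih
      obtain ⟨w, hw, e'⟩ := step z hz
      exact ⟨w, hw, by rw [e', e]; push_cast; ring⟩
  obtain ⟨z, hz, e⟩ := all (x : ZMod n).val
  have : NeZero n := ⟨by omega⟩
  rw [ZMod.natCast_zmod_val, sub_self] at e
  exact z.ne_zero e

section action
variable {n : ℕ} {Q : Type} [Group Q]

/-- Points of the projective line over `ZMod n`. -/
abbrev PL (n : ℕ) := ZMod n ⊕ {k : ZMod n // ¬ IsUnit k}

open Classical in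
noncomputable def sFun (γ : (ZMod n)ˣ → Q) : PL n × Q → PL n × Q
  | (Sum.inl k, q) => if h : IsUnit k then (Sum.inl (sg h.unit : ZMod n), q * γ h.unit)
      else (Sum.inr ⟨k, h⟩, q)
  | (Sum.inr m, q) => (Sum.inl m, q)

open Classical in
noncomputable def tFun (t : Q) (u : ZMod n → Q) : PL n × Q → PL n × Q
  | (Sum.inl k, q) => (Sum.inl (k + 1), q * (if k = -1 then t else 1))
  | (Sum.inr m, q) => (Sum.inr m, q * u m)

open Classical in
noncomputable def tInv (t : Q) (u : ZMod n → Q) : PL n × Q → PL n × Q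
  | (Sum.inl k, q) => (Sum.inl (k - 1), q * (if k = 0 then t⁻¹ else 1))
  | (Sum.inr m, q) => (Sum.inr m, q * (u m)⁻¹)

lemma sFun_unit (γ : (ZMod n)ˣ → Q) (x : (ZMod n)ˣ) (q : Q) :
    sFun γ (Sum.inl (x : ZMod n), q) = (Sum.inl (sg x : ZMod n), q * γ x) := by
  simp [sFun]

lemma sFun_non (γ : (ZMod n)ˣ → Q) (m : {k : ZMod n // ¬ IsUnit k}) (q : Q) :
    sFun γ (Sum.inl (m : ZMod n), q) = (Sum.inr m, q) := by
  simp [sFun, m.2]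

lemma sFun_inr (γ : (ZMod n)ˣ → Q) (m : {k : ZMod n // ¬ IsUnit k}) (q : Q) :
    sFun γ (Sum.inr m, q) = (Sum.inl (m : ZMod n), q) := rfl

lemma tFun_inl (t : Q) (u : ZMod n → Q) (k : ZMod n) (hk : k ≠ -1) (q : Q) :
    tFun t u (Sum.inl k, q) = (Sum.inl (k + 1), q) := by
  simp [tFun, hk]

lemma s_inv (γ : (ZMod n)ˣ → Q) (R1 : ∀ x, γ x * γ (sg x) = 1) :
    Function.Involutive (sFun γ) := by
  rintro ⟨k | m, q⟩
  · by_cases h : IsUnit k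
    · obtain ⟨x, rfl⟩ := h
      rw [sFun_unit, sFun_unit, sg_sg, mul_assoc, R1, mul_one]
    · rw [show k = ((⟨k, h⟩ : {k : ZMod n // ¬ IsUnit k}) : ZMod n) from rfl, sFun_non, sFun_inr]
  · rw [sFun_inr, sFun_non]

lemma t_left (t : Q) (u : ZMod n → Q) : Function.LeftInverse (tInv t u) (tFun t u) := by
  rintro ⟨k | m, q⟩
  · by_cases h : k = -1 <;> simp [tFun, tInv, h, add_eq_zero_iff_eq_neg]
  · simp [tFun, tInv]

lemma t_right (t : Q) (u : ZMod n → Q) : Function.RightInverse (tInv t u) (tFun t u) := by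
  rintro ⟨k | m, q⟩
  · by_cases h : k = 0 <;> simp [tFun, tInv, h]
  · simp [tFun, tInv]

noncomputable def sPerm (γ : (ZMod n)ˣ → Q) (R1 : ∀ x, γ x * γ (sg x) = 1) :
    Equiv.Perm (PL n × Q) := (s_inv γ R1).toPerm

noncomputable def tPerm (t : Q) (u : ZMod n → Q) : Equiv.Perm (PL n × Q) :=
  ⟨tFun t u, tInv t u, t_left t u, t_right t u⟩

open Classical in
lemma st3 (hn : 1 < n) (hnil : ∀ k : ZMod n, ¬ IsUnit k → k * k = 0)
    (γ : (ZMod n)ˣ → Q) (t : Q)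
    (R2 : ∀ x ∈ Ud n, γ x * γ (rho x) * γ (rho (rho x)) = 1) :
    ∃ u : ZMod n → Q, ∀ y, sFun γ (tFun t u (sFun γ (tFun t u (sFun γ (tFun t u y))))) = y := by
  have : Fact (1 < n) := ⟨hn⟩
  have hone : ∀ m : ZMod n, ¬ IsUnit m → IsUnit (m + 1) := by
    intro m hm
    exact IsUnit.of_mul_eq_one (1 - m) (by linear_combination -hnil m hm)
  let γ' : ZMod n → Q := fun k => if h : IsUnit k then γ h.unit else 1
  have hγ' : ∀ x : (ZMod n)ˣ, γ' x = γ x := by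
    intro x
    simp [γ']
  let a : ZMod n → Q := fun m => if m - 1 = -1 then t else 1
  refine ⟨fun m => (a m)⁻¹ * (γ' (m + 1))⁻¹, ?_⟩
  set u : ZMod n → Q := fun m => (a m)⁻¹ * (γ' (m + 1))⁻¹ with hu
  have tr : ∀ (m : {k : ZMod n // ¬ IsUnit k}) q, tFun t u (Sum.inr m, q) = (Sum.inr m, q * u m) :=
    fun _ _ => rfl
  have tl : ∀ (m : ZMod n) q, tFun t u (Sum.inl (m - 1), q) = (Sum.inl m, q * a m) := by
    intro m q; simp [tFun, a]
  have hm1 : ∀ m : {k : ZMod n // ¬ IsUnit k}, (m : ZMod n) ≠ -1 := by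
    intro m h; exact m.2 (by rw [h]; simp)
  have hs : ∀ (m : {k : ZMod n // ¬ IsUnit k}) q, sFun γ (Sum.inl ((m : ZMod n) + 1), q)
      = (Sum.inl ((m : ZMod n) - 1), q * γ' (m + 1)) := by
    intro m q
    obtain ⟨x, hx⟩ := hone m m.2
    have h1 := sg_unique x (m - 1) (by rw [hx]; linear_combination hnil m m.2)
    rw [← hx, sFun_unit, h1, hγ']
  rintro ⟨k | m, q⟩
  · by_cases hk : IsUnit k
    · by_cases hk1 : IsUnit (k + 1)
      · obtain ⟨x, hx⟩ := hk1
        have hkx : k = x - 1 := by rw [hx]; ring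
        have hxU : x ∈ Ud n := by change IsUnit _; rwa [← hkx]
        have hne : ∀ y ∈ Ud n, (sg y : ZMod n) ≠ -1 := by
          intro y hy h
          have := rho_eq hy
          rw [h] at this
          simp at this
        have hk1 : k ≠ -1 := by
          rintro rfl
          simp at hx
        have h3 := rho_eq (rho_mem (rho_mem hxU))
        rw [rho3 hxU] at h3
        rw [tFun_inl _ _ _ hk1, ← hx, sFun_unit, tFun_inl _ _ _ (hne _ hxU), ← rho_eq hxU,
          sFun_unit, tFun_inl _ _ _ (hne _ (rho_mem hxU)), ← rho_eq (rho_mem hxU), sFun_unit,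
          mul_assoc, mul_assoc, ← mul_assoc (γ x), R2 x hxU, mul_one, hkx, h3]
        simp
      · let m : {k : ZMod n // ¬ IsUnit k} := ⟨k + 1, hk1⟩
        have hkm : k = (m : ZMod n) - 1 := by simp [m]
        rw [hkm, tl, sFun_non, tr, sFun_inr, tFun_inl _ _ _ (hm1 m), hs, hu]
        simp [mul_assoc]
    · let m : {k : ZMod n // ¬ IsUnit k} := ⟨k, hk⟩
      have hkm : k = (m : ZMod n) := rfl
      rw [hkm, tFun_inl _ _ _ (hm1 m), hs, tl, sFun_non, tr, sFun_inr, hu]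
      simp [mul_assoc]
  · rw [tr, sFun_inr, tFun_inl _ _ _ (hm1 m), hs, tl, sFun_non, hu]
    simp [mul_assoc]

open ModularGroup in
lemma exists_action (hn : 1 < n) (hnil : ∀ k : ZMod n, ¬ IsUnit k → k * k = 0)
    (γ : (ZMod n)ˣ → Q) (t : Q) (R1 : ∀ x, γ x * γ (sg x) = 1)
    (R2 : ∀ x ∈ Ud n, γ x * γ (rho x) * γ (rho (rho x)) = 1) :
    ∃ Φ : PSL2Z →* Equiv.Perm (PL n × Q),
      (∀ q, Φ (projPSL (T ^ (n : ℤ))) (Sum.inl 0, q) = (Sum.inl 0, q * t⁻¹)) ∧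
      (∀ (x : (ZMod n)ˣ) q, Φ (projPSL (T ^ ((x : ZMod n).val : ℤ) * S *
          T ^ (-((sg x : ZMod n).val : ℤ)))) (Sum.inl 0, q) = (Sum.inl 0, q * (γ x)⁻¹)) := by
  have : NeZero n := ⟨by omega⟩
  obtain ⟨u, hu⟩ := st3 hn hnil γ t R2
  let s0 := sPerm γ R1
  let t0 : Equiv.Perm (PL n × Q) := tPerm t u
  have ht0 : ∀ y, t0 y = tFun t u y := fun _ => rfl
  have hs0 : ∀ y, s0 y = sFun γ y := fun _ => rfl
  have hs2 : s0 ^ 2 = 1 := by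
    ext1 y
    rw [pow_two]
    exact s_inv γ R1 y
  have hst : (s0 * t0) ^ 3 = 1 := by
    ext1 y
    rw [pow_three]
    exact hu y
  have hs' : s0⁻¹ = s0 := by
    rw [pow_two] at hs2; exact (eq_inv_of_mul_eq_one_left hs2).symm
  obtain ⟨Φ, h1, h2⟩ := exists_hom s0 (t0⁻¹ * s0) hs2 (by
    rw [← _root_.inv_inj, ← inv_pow, _root_.mul_inv_rev, inv_inv, hs', hst, inv_one])
  have hT : Φ (projPSL T) = t0⁻¹ := by
    rw [map_mul, map_mul, h1] at h2
    exact mul_right_cancel h2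
  have hpow : ∀ (m : ℕ) (q : Q), m < n → (t0 ^ m) (Sum.inl 0, q) = (Sum.inl (m : ZMod n), q) := by
    intro m q
    induction m with
    | zero => intro _; simp
    | succ m ih =>
      intro h
      rw [pow_succ', Equiv.Perm.mul_apply, ih (by omega)]
      rw [ht0]
      rw [tFun_inl]
      · simp
      · intro h'
        have : ((m + 1 : ℕ) : ZMod n) = 0 := by push_cast; rw [h']; ring
        rw [ZMod.natCast_eq_zero_iff] at this
        exact absurd (Nat.le_of_dvd (by omega) this) (by omega)
  have hpown : ∀ q : Q, (t0 ^ n) (Sum.inl 0, q) = (Sum.inl 0, q * t) := by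
    intro q
    obtain ⟨m, rfl⟩ : ∃ m, n = m + 1 := ⟨n - 1, by omega⟩
    rw [pow_succ', Equiv.Perm.mul_apply, hpow m q (by omega)]
    rw [ht0]
    have h0 : (m : ZMod (m + 1)) + 1 = 0 := by
      have := ZMod.natCast_self (m + 1)
      push_cast at this; exact this
    have h1 : (m : ZMod (m + 1)) = -1 := by rw [eq_neg_iff_add_eq_zero, h0]
    simp [tFun, h1]
  refine ⟨Φ, ?_, ?_⟩
  · intro q
    rw [map_zpow, map_zpow, hT, zpow_natCast, inv_pow, Equiv.Perm.inv_eq_iff_eq, hpown]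
    simp
  · intro x q
    rw [map_mul, map_mul, map_zpow, map_zpow, map_mul, map_mul, map_zpow, map_zpow, hT, h1,
      Equiv.Perm.mul_apply, Equiv.Perm.mul_apply, _root_.zpow_neg, _root_.inv_zpow, _root_.inv_zpow, inv_inv, zpow_natCast, zpow_natCast,
      hpow _ _ (ZMod.val_lt _), ZMod.natCast_zmod_val,
      Equiv.Perm.inv_eq_iff_eq, hpow _ _ (ZMod.val_lt _), ZMod.natCast_zmod_val]
    rw [hs0]
    rw [sFun_unit, sg_sg, eq_inv_of_mul_eq_one_right (R1 x)]

end action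

/-- Pairs `(A, B)` where `B` is `A` conjugated by `diag(n, 1)`. -/
def CJ (n : ℕ) : Subgroup (SL2Z × SL2Z) where
  carrier := {P | P.2 0 0 = P.1 0 0 ∧ P.2 0 1 = n * P.1 0 1 ∧ P.1 1 0 = n * P.2 1 0 ∧
    P.2 1 1 = P.1 1 1}
  one_mem' := by simp
  mul_mem' := by
    rintro ⟨A, B⟩ ⟨A', B'⟩ ⟨h1, h2, h3, h4⟩ ⟨h1', h2', h3', h4'⟩
    have g1 : B 0 0 = A 0 0 := h1
    have g2 : B 0 1 = n * A 0 1 := h2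
    have g3 : A 1 0 = n * B 1 0 := h3
    have g4 : B 1 1 = A 1 1 := h4
    have g1' : B' 0 0 = A' 0 0 := h1'
    have g2' : B' 0 1 = n * A' 0 1 := h2'
    have g3' : A' 1 0 = n * B' 1 0 := h3'
    have g4' : B' 1 1 = A' 1 1 := h4'
    refine ⟨?_, ?_, ?_, ?_⟩
    · change (B * B') 0 0 = (A * A') 0 0
      rw [sl_mul, sl_mul, g1, g2, g1', g3']; ring
    · change (B * B') 0 1 = n * (A * A') 0 1
      rw [sl_mul, sl_mul, g1, g2, g2', g4']; ring
    · change (A * A') 1 0 = n * (B * B') 1 0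
      rw [sl_mul, sl_mul, g3, g4, g1', g3']; ring
    · change (B * B') 1 1 = (A * A') 1 1
      rw [sl_mul, sl_mul, g3, g4, g2', g4']; ring
  inv_mem' := by
    rintro ⟨A, B⟩ ⟨h1, h2, h3, h4⟩
    dsimp only at *
    refine ⟨?_, ?_, ?_, ?_⟩ <;> simp only [Prod.inv_mk, sl_inv00, sl_inv01, sl_inv10, sl_inv11]
    · exact h4
    · rw [h2]; ring
    · rw [h3]; ring
    · exact h1

lemma CJ_iff (n : ℕ) (A B : SL2Z) : (A, B) ∈ CJ n ↔
    (B 0 0 = A 0 0 ∧ B 0 1 = n * A 0 1 ∧ A 1 0 = n * B 1 0 ∧ B 1 1 = A 1 1) := Iff.rfl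

lemma sl_ext (A B : SL2Z) (h1 : A 0 0 = B 0 0) (h2 : A 0 1 = B 0 1) (h3 : A 1 0 = B 1 0)
    (h4 : A 1 1 = B 1 1) : A = B := by
  ext i j
  fin_cases i <;> fin_cases j <;> assumption

lemma CJ_pm {n : ℕ} (hn : 1 < n) {A B : SL2Z} (h : (A, B) ∈ CJ n) :
    projPSL A = 1 ↔ projPSL B = 1 := by
  have hn0 : (n : ℤ) ≠ 0 := by exact_mod_cast (by omega : n ≠ 0)
  rw [projPSL_eq_one, projPSL_eq_one]
  obtain ⟨h1, h2, h3, h4⟩ := h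
  dsimp only at *
  constructor
  · rintro (rfl | rfl)
    · left; apply sl_ext <;> simp_all
    · right; apply sl_ext <;> simp_all
  · rintro (rfl | rfl)
    · left; apply sl_ext <;> simp_all
    · right; apply sl_ext <;> simp_all

lemma exists_sl (a b c d : ℤ) (h : a * d - b * c = 1) :
    ∃ A : SL2Z, A 0 0 = a ∧ A 0 1 = b ∧ A 1 0 = c ∧ A 1 1 = d :=
  ⟨⟨!![a, b; c, d], by rw [Matrix.det_fin_two]; exact h⟩, rfl, rfl, rfl, rfl⟩

lemma sl_det (A : SL2Z) : A 0 0 * A 1 1 - A 0 1 * A 1 0 = 1 := by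
  have := A.det_coe
  rw [Matrix.det_fin_two] at this
  exact this

lemma CJ_of_gamma0 {n : ℕ} {A : SL2Z} (h : A ∈ CongruenceSubgroup.Gamma0 n) :
    ∃ B, (A, B) ∈ CJ n := by
  rw [CongruenceSubgroup.Gamma0_mem, ZMod.intCast_zmod_eq_zero_iff_dvd] at h
  obtain ⟨c, hc⟩ := h
  have h1 := sl_det A
  obtain ⟨B, h2, h3, h4, h5⟩ := exists_sl (A 0 0) (n * A 0 1) c (A 1 1) (by
    have hc' : A 1 0 = n * c := hc
    rw [hc'] at h1
    linarith)
  refine ⟨B, ?_⟩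
  rw [CJ_iff]
  exact ⟨h2, h3, by rw [h4]; exact hc, h5⟩

lemma gamma0_of_CJ {n : ℕ} {A B : SL2Z} (h : (A, B) ∈ CJ n) :
    A ∈ CongruenceSubgroup.Gamma0 n := by
  rw [CongruenceSubgroup.Gamma0_mem, ZMod.intCast_zmod_eq_zero_iff_dvd]
  exact ⟨_, h.2.2.1⟩

lemma CJ_T (n : ℕ) : (ModularGroup.T, ModularGroup.T ^ (n : ℤ)) ∈ CJ n := by
  simp only [CJ_iff, ModularGroup.coe_T_zpow, ModularGroup.coe_T]
  simp

/-- The matrix word `T^k S T^{-l}`. -/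
def wd (k l : ℤ) : SL2Z := ModularGroup.T ^ k * ModularGroup.S * ModularGroup.T ^ (-l)

lemma exists_gm {n : ℕ} (hn : 1 < n) (x : (ZMod n)ˣ) : ∃ A : SL2Z,
    A 0 0 = (x : ZMod n).val ∧ A 1 0 = n ∧ A 1 1 = -((sg x : ZMod n).val : ℤ) ∧
    n * A 0 1 = -(1 + (x : ZMod n).val * (sg x : ZMod n).val) ∧
    (A, wd (x : ZMod n).val (sg x : ZMod n).val) ∈ CJ n := by
  have : NeZero n := ⟨by omega⟩
  have hd : (n : ℤ) ∣ 1 + (x : ZMod n).val * (sg x : ZMod n).val := by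
    rw [← ZMod.intCast_zmod_eq_zero_iff_dvd]
    push_cast
    rw [ZMod.natCast_zmod_val, ZMod.natCast_zmod_val, mul_comm, sg_mul]
    ring
  obtain ⟨b, hb⟩ := hd
  generalize ((x : ZMod n).val : ℤ) = u at *
  generalize ((sg x : ZMod n).val : ℤ) = v at *
  obtain ⟨A, h1, h2, h3, h4⟩ := exists_sl u (-b) n (-v) (by linarith)
  refine ⟨A, h1, h3, h4, ?_, ?_⟩
  · rw [h2, hb]; ring
  · rw [CJ_iff, h1, h2, h3, h4]
    simp only [wd, sl_mul, ModularGroup.coe_T_zpow, ModularGroup.coe_S]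
    simp
    linarith

lemma val_rho {n : ℕ} (hn : 1 < n) {x : (ZMod n)ˣ} (h : x ∈ Ud n) :
    ((rho x : ZMod n).val : ℤ) = (sg x : ZMod n).val + 1 := by
  have : Fact (1 < n) := ⟨hn⟩
  have : NeZero n := ⟨by omega⟩
  have h1 : (rho x : ZMod n).val = (sg x : ZMod n).val + 1 := by
    have h0 := rho_eq h
    have hlt := ZMod.val_lt (sg x : ZMod n)
    rcases Nat.lt_or_ge ((sg x : ZMod n).val + 1) n with h2 | h2
    · rw [h0, ZMod.val_add_of_lt]
      · rw [ZMod.val_one]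
      · rwa [ZMod.val_one]
    · exfalso
      have h3 : (sg x : ZMod n).val + 1 = n := by omega
      have h4 : (((sg x : ZMod n).val + 1 : ℕ) : ZMod n) = 0 := by rw [h3]; simp
      push_cast at h4
      rw [ZMod.natCast_zmod_val, ← h0] at h4
      exact (rho x).ne_zero h4
  exact_mod_cast h1

lemma proj_wd (k l : ℤ) : projPSL (wd k l) = projPSL ModularGroup.T ^ k * sbar *
    projPSL ModularGroup.T ^ (-l) := by
  simp [wd, sbar]

lemma wd_R1 (k l : ℤ) : projPSL (wd k l * wd l k) = 1 := by
  rw [map_mul, proj_wd, proj_wd]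
  have h := sbar2
  rw [pow_two] at h
  generalize projPSL ModularGroup.T = t
  have : t ^ k * sbar * t ^ (-l) * (t ^ l * sbar * t ^ (-k)) = t ^ k * (sbar * sbar) * t ^ (-k) := by
    group
  rw [this, h]
  group

lemma wd_R2 (a b c : ℤ) : projPSL (wd (a + 1) b * wd (b + 1) c * wd (c + 1) a) = 1 := by
  rw [map_mul, map_mul, proj_wd, proj_wd, proj_wd]
  have h := ubar3
  rw [ubar, map_mul, pow_three] at h
  change projPSL ModularGroup.T * sbar * (projPSL ModularGroup.T * sbar *
    (projPSL ModularGroup.T * sbar)) = 1 at h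
  revert h
  generalize projPSL ModularGroup.T = t
  intro h
  have : t ^ (a + 1) * sbar * t ^ (-b) * (t ^ (b + 1) * sbar * t ^ (-c)) *
    (t ^ (c + 1) * sbar * t ^ (-a)) = t ^ a * (t * sbar * (t * sbar * (t * sbar))) * t ^ (-a) := by
    group
  rw [this, h]
  group

section schreier
variable {n : ℕ} (L : Subgroup SL2Z)
open ModularGroup

lemma schreier_unit (hn : 1 < n) (hT : T ^ (n : ℤ) ∈ L)
    (hg : ∀ x : (ZMod n)ˣ, wd (x : ZMod n).val (sg x : ZMod n).val ∈ L) (k l : ℤ)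
    (hkl : (l : ZMod n) * k = -1) : wd k l ∈ L := by
  have : NeZero n := ⟨by omega⟩
  have hTm : ∀ m : ℤ, (n : ℤ) ∣ m → T ^ m ∈ L := by
    rintro _ ⟨c, rfl⟩
    rw [_root_.zpow_mul]
    exact L.zpow_mem hT c
  have hu : IsUnit (k : ZMod n) :=
    IsUnit.of_mul_eq_one (-(l : ZMod n)) (by linear_combination -hkl)
  obtain ⟨x, hx⟩ := hu
  have hs := sg_unique x l (by rw [hx, hkl])
  have e : wd k l = T ^ (k - (x : ZMod n).val) * wd (x : ZMod n).val (sg x : ZMod n).val *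
      T ^ ((sg x : ZMod n).val - l) := by
    simp only [wd]; group
  rw [e]
  refine L.mul_mem (L.mul_mem (hTm _ ?_) (hg x)) (hTm _ ?_)
  · rw [← ZMod.intCast_zmod_eq_zero_iff_dvd]
    push_cast
    rw [ZMod.natCast_zmod_val, hx, sub_self]
  · rw [← ZMod.intCast_zmod_eq_zero_iff_dvd]
    push_cast
    rw [ZMod.natCast_zmod_val, hs, sub_self]

lemma schreier (hn : 1 < n) (hnil : ∀ k : ZMod n, ¬ IsUnit k → k * k = 0)
    (hneg : (-1 : SL2Z) ∈ L) (hT : T ^ (n : ℤ) ∈ L)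
    (hg : ∀ x : (ZMod n)ˣ, wd (x : ZMod n).val (sg x : ZMod n).val ∈ L) (B : SL2Z) :
    ∃ l ∈ L, ∃ k : ℤ, B = l * T ^ k ∨ B = l * (T ^ k * S) := by
  have : NeZero n := ⟨by omega⟩
  suffices h : ∃ l ∈ L, ∃ k : ℤ, B = l * T ^ k ∨ (¬ IsUnit (k : ZMod n) ∧ B = l * (T ^ k * S)) by
    obtain ⟨l, hl, k, h⟩ := h
    exact ⟨l, hl, k, h.imp id And.right⟩
  have hS : ∀ l ∈ L, ∀ k : ℤ, ∃ l' ∈ L, ∃ k' : ℤ, l * (T ^ k * S) = l' * T ^ k' ∨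
      (¬ IsUnit (k' : ZMod n) ∧ l * (T ^ k * S) = l' * (T ^ k' * S)) := by
    intro l hl k
    by_cases hk : IsUnit (k : ZMod n)
    · obtain ⟨x, hx⟩ := hk
      refine ⟨l * wd k (sg x : ZMod n).val, L.mul_mem hl (schreier_unit L hn hT hg _ _ ?_),
        (sg x : ZMod n).val, Or.inl ?_⟩
      · push_cast
        rw [ZMod.natCast_zmod_val, ← hx, sg_mul]
      · simp only [wd]; group
    · exact ⟨l, hl, k, Or.inr ⟨hk, rfl⟩⟩
  have hTS : ∀ k : ℤ, ¬ IsUnit (k : ZMod n) → T ^ k * S * T * S⁻¹ * T ^ (-k) ∈ L := by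
    intro k hk
    have e : S * T * S⁻¹ = -1 * (T⁻¹ * S * T⁻¹) := by decide
    have e2 : T ^ k * S * T * S⁻¹ * T ^ (-k) = -1 * wd (k - 1) (k + 1) := by
      have : T ^ k * S * T * S⁻¹ * T ^ (-k) = T ^ k * (S * T * S⁻¹) * T ^ (-k) := by group
      have h2 : T ^ k * -1 = -1 * T ^ k := by simp
      rw [this, e, ← mul_assoc, h2, mul_assoc, mul_assoc]
      congr 1
      simp only [wd]
      group
    rw [e2]
    refine L.mul_mem hneg ?_
    apply schreier_unit L hn hT hg
    push_cast
    linear_combination hnil _ hk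
  have hB : B ∈ Subgroup.closure {S, T} := by
    rw [SpecialLinearGroup.SL2Z_generators]; trivial
  have hSinv : S⁻¹ = -1 * S := by decide
  have hSS : S * S = -1 := by decide
  have hcomm : ∀ A : SL2Z, A * -1 = -1 * A := by intro A; simp
  have stepS : ∀ x : SL2Z, (∃ l ∈ L, ∃ k : ℤ, x = l * T ^ k ∨ (¬ IsUnit (k : ZMod n) ∧ x = l * (T ^ k * S))) →
      ∃ l ∈ L, ∃ k : ℤ, x * S = l * T ^ k ∨ (¬ IsUnit (k : ZMod n) ∧ x * S = l * (T ^ k * S)) := by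
    rintro x ⟨l, hl, k, rfl | ⟨hk, rfl⟩⟩
    · rw [mul_assoc]; exact hS l hl k
    · refine ⟨l * -1, L.mul_mem hl hneg, k, Or.inl ?_⟩
      rw [mul_assoc, mul_assoc, hSS, hcomm, mul_assoc]
  induction hB using Subgroup.closure_induction_right with
  | one => exact ⟨1, L.one_mem, 0, Or.inl (by simp)⟩
  | mul_right x hx y hy ih =>
    rcases hy with rfl | rfl
    · exact stepS x ih
    · obtain ⟨l, hl, k, rfl | ⟨hk, rfl⟩⟩ := ih
      · exact ⟨l, hl, k + 1, Or.inl (by group)⟩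
      · refine ⟨_, L.mul_mem hl (hTS k hk), k, Or.inr ⟨hk, ?_⟩⟩
        group
  | mul_inv_cancel x hx y hy ih =>
    rcases hy with rfl | rfl
    · obtain ⟨l, hl, k, h⟩ := stepS x ih
      refine ⟨-1 * l, L.mul_mem hneg hl, k, ?_⟩
      rw [hSinv, ← mul_assoc, hcomm, mul_assoc, mul_assoc, mul_assoc]
      rcases h with h | ⟨h1, h⟩
      · exact Or.inl (by rw [h])
      · exact Or.inr ⟨h1, by rw [h]⟩
    · obtain ⟨l, hl, k, rfl | ⟨hk, rfl⟩⟩ := ih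
      · exact ⟨l, hl, k - 1, Or.inl (by group)⟩
      · refine ⟨_, L.mul_mem hl (L.inv_mem (hTS k hk)), k, Or.inr ⟨hk, ?_⟩⟩
        group
end schreier

open ModularGroup in
lemma gen_gamma0 {n : ℕ} (hn : 1 < n) (hnil : ∀ k : ZMod n, ¬ IsUnit k → k * k = 0)
    (gm : (ZMod n)ˣ → SL2Z)
    (hgm : ∀ x, (gm x, wd (x : ZMod n).val (sg x : ZMod n).val) ∈ CJ n)
    (R : Subgroup PSL2Z) (hT : projPSL T ∈ R) (hg : ∀ x, projPSL (gm x) ∈ R)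
    (A : SL2Z) (hA : A ∈ CongruenceSubgroup.Gamma0 n) : projPSL A ∈ R := by
  obtain ⟨B, hAB⟩ := CJ_of_gamma0 hA
  have hn0 : (n : ℤ) ≠ 0 := by exact_mod_cast (by omega : n ≠ 0)
  let L : Subgroup SL2Z := ((R.comap projPSL).comap (MonoidHom.fst SL2Z SL2Z) ⊓ CJ n).map
    (MonoidHom.snd SL2Z SL2Z)
  have hL : ∀ A B, (A, B) ∈ CJ n → projPSL A ∈ R → B ∈ L :=
    fun A B h1 h2 => ⟨(A, B), ⟨h2, h1⟩, rfl⟩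
  have hL' : ∀ B ∈ L, ∃ A, (A, B) ∈ CJ n ∧ projPSL A ∈ R := by
    rintro _ ⟨⟨A, B⟩, ⟨h2, h1⟩, rfl⟩
    exact ⟨A, h1, h2⟩
  have hTn := hL _ _ (CJ_T n) hT
  obtain ⟨l, hl, k, h⟩ := schreier L hn hnil
    (hL (-1) (-1) (by simp [CJ_iff]) (by
      rw [(projPSL_eq_one (-1)).2 (Or.inr rfl)]; exact R.one_mem))
    hTn (fun x => hL _ _ (hgm x) (hg x)) B
  obtain ⟨A1, h1, h2⟩ := hL' l hl
  have h3 : (A1⁻¹ * A, l⁻¹ * B) ∈ CJ n := (CJ n).mul_mem ((CJ n).inv_mem h1) hAB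
  have hd : (n : ℤ) ∣ (l⁻¹ * B) 0 1 := ⟨_, h3.2.1⟩
  have hBL : B ∈ L := by
    rcases h with h | h
    · have e : l⁻¹ * B = T ^ k := by rw [h]; group
      rw [e, ModularGroup.coe_T_zpow] at hd
      simp at hd
      obtain ⟨c, rfl⟩ := hd
      rw [h, _root_.zpow_mul]
      exact L.mul_mem hl (L.zpow_mem hTn c)
    · have e : l⁻¹ * B = T ^ k * S := by rw [h]; group
      rw [e, sl_mul, ModularGroup.coe_T_zpow, ModularGroup.coe_S] at hd
      simp at hd
      have := Int.le_of_dvd one_pos hd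
      omega
  obtain ⟨A2, h4, h5⟩ := hL' B hBL
  have : A = A2 := by
    rw [CJ_iff] at hAB h4
    apply sl_ext
    · rw [← hAB.1, h4.1]
    · exact mul_left_cancel₀ hn0 (by rw [← hAB.2.1, h4.2.1])
    · rw [hAB.2.2.1, h4.2.2.1]
    · rw [← hAB.2.2.2, h4.2.2.2]
  rw [this]; exact h5

lemma hnil_of {n : ℕ} (hn : Nat.Prime n ∨ ∃ p : ℕ, Nat.Prime p ∧ n = p ^ 2) (k : ZMod n)
    (hk : ¬ IsUnit k) : k * k = 0 := by
  have hn0 : NeZero n := by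
    refine ⟨?_⟩
    rcases hn with h | ⟨p, h, rfl⟩
    · exact h.ne_zero
    · exact pow_ne_zero _ h.ne_zero
  rw [← ZMod.natCast_zmod_val k, ZMod.isUnit_iff_coprime] at hk
  rw [← ZMod.natCast_zmod_val k, ← Nat.cast_mul, ZMod.natCast_eq_zero_iff]
  rcases hn with h | ⟨p, h, rfl⟩
  · rw [Nat.coprime_comm, h.coprime_iff_not_dvd, not_not] at hk
    exact dvd_mul_of_dvd_left hk _
  · have : p ∣ k.val := by
      by_contra h2
      exact hk (Nat.Coprime.pow_right 2 ((h.coprime_iff_not_dvd.2 h2).symm))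
    have h3 := mul_dvd_mul this this
    rwa [← pow_two p] at h3

lemma val_pos_unit {n : ℕ} (hn : 1 < n) (x : (ZMod n)ˣ) :
    (1 : ℤ) ≤ (x : ZMod n).val ∧ ((x : ZMod n).val : ℤ) ≤ n - 1 := by
  have : NeZero n := ⟨by omega⟩
  have : Fact (1 < n) := ⟨hn⟩
  have h1 := ZMod.val_lt (x : ZMod n)
  have h2 : (x : ZMod n).val ≠ 0 := by
    rw [Ne, ZMod.val_eq_zero]; exact x.ne_zero
  omega

lemma pg_R1 {n : ℕ} (hn : 1 < n) (gm : (ZMod n)ˣ → SL2Z)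
    (hgm : ∀ x, (gm x, wd (x : ZMod n).val (sg x : ZMod n).val) ∈ CJ n) (x : (ZMod n)ˣ) :
    projPSL (gm x) * projPSL (gm (sg x)) = 1 := by
  have h := (CJ n).mul_mem (hgm x) (hgm (sg x))
  rw [Prod.mk_mul_mk] at h
  rw [← map_mul, CJ_pm hn h, sg_sg]
  exact wd_R1 _ _

lemma pg_R2 {n : ℕ} (hn : 1 < n) (gm : (ZMod n)ˣ → SL2Z)
    (hgm : ∀ x, (gm x, wd (x : ZMod n).val (sg x : ZMod n).val) ∈ CJ n) (x : (ZMod n)ˣ)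
    (hx : x ∈ Ud n) :
    projPSL (gm x) * projPSL (gm (rho x)) * projPSL (gm (rho (rho x))) = 1 := by
  have h := (CJ n).mul_mem ((CJ n).mul_mem (hgm x) (hgm (rho x))) (hgm (rho (rho x)))
  rw [Prod.mk_mul_mk, Prod.mk_mul_mk] at h
  rw [← map_mul, ← map_mul, CJ_pm hn h]
  have h1 := val_rho hn hx
  have h2 := val_rho hn (rho_mem hx)
  have h3 := val_rho hn (rho_mem (rho_mem hx))
  rw [rho3 hx] at h3
  rw [h1, h2, h3]
  exact wd_R2 _ _ _

lemma norm_bound {n : ℕ} (hn : 1 < n) (a b c d : ℤ) (ha : 1 ≤ a ∧ a ≤ n - 1)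
    (hd : 1 ≤ d ∧ d ≤ n - 1) (hc : c = n) (hb : n * b = -(1 + a * d)) :
    Real.sqrt ((a : ℝ) ^ 2 + (b : ℝ) ^ 2 + (c : ℝ) ^ 2 + ((-d : ℤ) : ℝ) ^ 2) < 2 * (n : ℝ) - 1 := by
  have hn' : (2 : ℤ) ≤ n := by exact_mod_cast hn
  have hn2 : (2 : ℝ) ≤ n := by exact_mod_cast hn
  have hb1 : b ≤ 0 := by nlinarith
  have hb2 : -(n - 1 : ℤ) ≤ b := by
    have h1 : a * d ≤ (n - 1) * (n - 1) := by
      apply mul_le_mul ha.2 hd.2 <;> linarith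
    nlinarith
  rw [Real.sqrt_lt' (by linarith)]
  have : a ^ 2 + b ^ 2 + c ^ 2 + (-d) ^ 2 < (2 * (n : ℤ) - 1) ^ 2 := by
    subst hc
    have e1 : a ^ 2 ≤ (n - 1 : ℤ) ^ 2 := by
      apply pow_le_pow_left₀ <;> linarith
    have e2 : d ^ 2 ≤ (n - 1 : ℤ) ^ 2 := by
      apply pow_le_pow_left₀ <;> linarith
    have e3 : (-b) ^ 2 ≤ (n - 1 : ℤ) ^ 2 := by
      apply pow_le_pow_left₀ <;> linarith
    nlinarith
  exact_mod_cast this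

lemma CJ_one (n : ℕ) : ((1 : SL2Z), (1 : SL2Z)) ∈ CJ n := by
  rw [← Prod.one_eq_mk]
  exact (CJ n).one_mem

lemma CJ_mul {n : ℕ} {A B A' B' : SL2Z} (h : (A, B) ∈ CJ n) (h' : (A', B') ∈ CJ n) :
    (A * A', B * B') ∈ CJ n := by
  have := (CJ n).mul_mem h h'
  rwa [Prod.mk_mul_mk] at this

lemma CJ_inv {n : ℕ} {A B : SL2Z} (h : (A, B) ∈ CJ n) : (A⁻¹, B⁻¹) ∈ CJ n := by
  have := (CJ n).inv_mem h
  rwa [Prod.inv_mk] at this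

lemma exists_W {n : ℕ} {Q X : Type} [Group Q] (lf : Q →* PSL2Z)
    (Φ : PSL2Z →* Equiv.Perm (X × Q)) (x0 : X) :
    ∃ W : Subgroup Q, ∀ w, w ∈ W ↔ ∃ A B : SL2Z, (A, B) ∈ CJ n ∧ projPSL A = lf w ∧
        ∀ q, Φ (projPSL B) (x0, q) = (x0, q * w⁻¹) := by
  refine ⟨{ carrier := {w | ∃ A B : SL2Z, (A, B) ∈ CJ n ∧ projPSL A = lf w ∧
              ∀ q, Φ (projPSL B) (x0, q) = (x0, q * w⁻¹)}
            one_mem' := ⟨1, 1, CJ_one n, ?_, ?_⟩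
            mul_mem' := ?_
            inv_mem' := ?_ }, fun w => Iff.rfl⟩
  · rintro w w' ⟨A, B, h1, h2, h3⟩ ⟨A', B', h1', h2', h3'⟩
    refine ⟨A * A', B * B', CJ_mul h1 h1', ?_, ?_⟩
    · rw [map_mul, map_mul, h2, h2']
    · intro q
      rw [map_mul, map_mul, Equiv.Perm.mul_apply, h3', h3, _root_.mul_inv_rev, mul_assoc]
  · rw [map_one, map_one]
  · intro q
    rw [map_one, map_one, inv_one, mul_one]
    rfl
  · rintro w ⟨A, B, h1, h2, h3⟩
    refine ⟨A⁻¹, B⁻¹, CJ_inv h1, ?_, ?_⟩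
    · rw [MonoidHom.map_inv lf w, ← h2]
      exact MonoidHom.map_inv projPSL A
    · intro q
      have e : projPSL B⁻¹ = (projPSL B)⁻¹ := MonoidHom.map_inv projPSL B
      rw [e, MonoidHom.map_inv Φ, Equiv.Perm.inv_eq_iff_eq, h3, inv_inv, mul_inv_cancel_right]

lemma core {n : ℕ} (hn1 : 1 < n) (hnil : ∀ k : ZMod n, ¬ IsUnit k → k * k = 0)
    (gm : (ZMod n)ˣ → SL2Z)
    (hgm : ∀ x, (gm x, wd (x : ZMod n).val (sg x : ZMod n).val) ∈ CJ n)
    (K K0 : Set (ZMod n)ˣ) (hK0K : K0 ⊆ K) (hK0 : ∀ x ∈ K, x ∈ K0 ∨ sg x ∈ K0)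
    (hK0' : ∀ x ∈ K0, sg x ∈ K0 → sg x = x)
    (hKf : ∀ (G : Type) [Group G] (f : (ZMod n)ˣ → G), (∀ x, f x * f (sg x) = 1) →
      (∀ x ∈ Ud n, rho x = x → f x ^ 3 = 1) →
      ∃ γ : (ZMod n)ˣ → G, (∀ x ∈ K, γ x = f x) ∧ (∀ x, γ x * γ (sg x) = 1) ∧
        ∀ x ∈ Ud n, γ x * γ (rho x) * γ (rho (rho x)) = 1)
    (hKg : ∀ (G : Type) [Group G] (γ : (ZMod n)ˣ → G) (L : Subgroup G),
      (∀ x, γ x * γ (sg x) = 1) →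
      (∀ x ∈ Ud n, γ x * γ (rho x) * γ (rho (rho x)) = 1) →
      (∀ x ∈ K, γ x ∈ L) → ∀ x, γ x ∈ L)
    {Q : Type} [Group Q] (lf : Q →* PSL2Z) (t : Q) (a : K0 → Q)
    (hlt : lf t = projPSL ModularGroup.T) (hla : ∀ x, lf (a x) = projPSL (gm x))
    (hapow : ∀ (x : K0) (m : ℕ), projPSL (gm x) ^ m = 1 → a x ^ m = 1)
    (hgen : ∀ W : Subgroup Q, t ∈ W → (∀ x, a x ∈ W) → ∀ w, w ∈ W) :
    Function.Injective lf ∧ lf.range = (CongruenceSubgroup.Gamma0 n).map projPSL := by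
  classical
  have R1 := pg_R1 hn1 gm hgm
  have R2 := pg_R2 hn1 gm hgm
  obtain ⟨f, hf0, hf1, hf2⟩ : ∃ f : (ZMod n)ˣ → Q, (∀ x (h : x ∈ K0), f x = a ⟨x, h⟩) ∧
      (∀ x, x ∉ K0 → ∀ h : sg x ∈ K0, f x = (a ⟨sg x, h⟩)⁻¹) ∧
      (∀ x, x ∉ K0 → sg x ∉ K0 → f x = 1) := by
    refine ⟨fun x => if h : x ∈ K0 then a ⟨x, h⟩ else
      if h : sg x ∈ K0 then (a ⟨sg x, h⟩)⁻¹ else 1, ?_, ?_, ?_⟩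
    · intro x h
      simp only [dif_pos h]
    · intro x h0 h
      simp only [dif_neg h0, dif_pos h]
    · intro x h0 h
      simp only [dif_neg h0, dif_neg h]
  have hfR1 : ∀ x, f x * f (sg x) = 1 := by
    intro x
    by_cases hx : x ∈ K0
    · by_cases hs : sg x ∈ K0
      · have h := hK0' x hx hs
        rw [h, hf0 x hx, ← pow_two]
        apply hapow
        have h' := R1 x
        rw [h] at h'
        rw [pow_two]; exact h'
      · have h2 : sg (sg x) ∈ K0 := by rw [sg_sg]; exact hx
        have e1 := hf1 (sg x) hs h2
        have e2 : a ⟨sg (sg x), h2⟩ = a ⟨x, hx⟩ := by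
          congr 1; exact Subtype.ext (sg_sg x)
        rw [e1, e2, hf0 x hx, mul_inv_cancel]
    · by_cases hs : sg x ∈ K0
      · rw [hf1 x hx hs, hf0 _ hs, inv_mul_cancel]
      · rw [hf2 x hx hs, hf2 (sg x) hs (by rw [sg_sg]; exact hx), mul_one]
  have hfR2 : ∀ x ∈ Ud n, rho x = x → f x ^ 3 = 1 := by
    intro x hx hr
    have h3 := R2 x hx
    rw [hr, hr] at h3
    have h3' : projPSL (gm x) ^ 3 = 1 := by rw [pow_three, ← mul_assoc]; exact h3
    by_cases hx : x ∈ K0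
    · rw [hf0 x hx]
      exact hapow _ _ h3'
    · by_cases hs : sg x ∈ K0
      · rw [hf1 x hx hs, inv_pow, hapow _ _ ?_, inv_one]
        change projPSL (gm (sg x)) ^ 3 = 1
        rw [eq_inv_of_mul_eq_one_right (R1 x), inv_pow, h3', inv_one]
      · rw [hf2 x hx hs, one_pow]
  obtain ⟨γ, hγ0, hγ1, hγ2⟩ := hKf Q f hfR1 hfR2
  obtain ⟨Φ, hΦ1, hΦ2⟩ := exists_action hn1 hnil γ t hγ1 hγ2
  obtain ⟨W, hWm⟩ := exists_W (n := n) lf Φ (Sum.inl 0)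
  have hWt : t ∈ W := (hWm t).2 ⟨ModularGroup.T, ModularGroup.T ^ (n : ℤ), CJ_T n, hlt.symm, hΦ1⟩
  have hWa : ∀ x, a x ∈ W := by
    intro x
    refine (hWm _).2 ⟨gm x, _, hgm x, (hla x).symm, ?_⟩
    intro q
    have h1 := hΦ2 x q
    rw [hγ0 x (hK0K x.2), hf0 x x.2] at h1
    exact h1
  have hW := hgen W hWt hWa
  constructor
  · rw [injective_iff_map_eq_one]
    intro w hw
    obtain ⟨A, B, h1, h2, h3⟩ := (hWm w).1 (hW w)
    rw [hw, CJ_pm hn1 h1] at h2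
    have h4 := h3 1
    rw [h2, map_one, Equiv.Perm.one_apply, one_mul] at h4
    exact (inv_eq_one.1 (Prod.ext_iff.1 h4).2.symm)
  · apply le_antisymm
    · rintro _ ⟨w, rfl⟩
      obtain ⟨A, B, h1, h2, h3⟩ := (hWm w).1 (hW w)
      exact ⟨A, gamma0_of_CJ h1, h2⟩
    · rintro _ ⟨A, hA, rfl⟩
      refine gen_gamma0 hn1 hnil gm hgm lf.range ⟨t, hlt⟩ ?_ A hA
      refine hKg PSL2Z (fun x => projPSL (gm x)) lf.range R1 R2 ?_
      intro x hx
      rcases hK0 x hx with h | h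
      · exact ⟨a ⟨x, h⟩, hla _⟩
      · refine ⟨(a ⟨sg x, h⟩)⁻¹, ?_⟩
        rw [map_inv, hla]
        exact (eq_inv_of_mul_eq_one_left (R1 x)).symm

lemma cop_gen {k : ℕ} (H : Option (Fin k) → Subgroup PSL2Z) (b : Option (Fin k) → PSL2Z)
    (hH : ∀ o, H o = Subgroup.zpowers (b o)) (hb : ∀ o, b o ∈ H o)
    (W : Subgroup (Monoid.CoprodI (fun o => H o)))
    (h : ∀ o, Monoid.CoprodI.of (M := fun o => H o) (i := o) ⟨b o, hb o⟩ ∈ W)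
    (w : Monoid.CoprodI (fun o => H o)) : w ∈ W := by
  induction w using Monoid.CoprodI.induction_on with
  | one => exact W.one_mem
  | mul x y hx hy => exact W.mul_mem hx hy
  | of o m =>
    obtain ⟨m, hm⟩ := m
    have hm' := hm
    rw [hH] at hm'
    obtain ⟨j, rfl⟩ := hm'
    have : (⟨_, hm⟩ : H o) = (⟨b o, hb o⟩ : H o) ^ j := Subtype.ext rfl
    rw [this, map_zpow]
    exact W.zpow_mem (h o) j

lemma cop_pow {k : ℕ} (H : Option (Fin k) → Subgroup PSL2Z) (b : Option (Fin k) → PSL2Z)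
    (hb : ∀ o, b o ∈ H o) (o : Option (Fin k)) (m : ℕ) (h : b o ^ m = 1) :
    (Monoid.CoprodI.of (M := fun o => H o) (i := o) ⟨b o, hb o⟩) ^ m = 1 := by
  rw [← map_pow]
  have : (⟨b o, hb o⟩ : H o) ^ m = 1 := Subtype.ext h
  rw [this, map_one]

lemma cop_lift {k : ℕ} (H : Option (Fin k) → Subgroup PSL2Z) (b : Option (Fin k) → PSL2Z)
    (hb : ∀ o, b o ∈ H o) (o : Option (Fin k)) :
    Monoid.CoprodI.lift (fun o => (H o).subtype)
      (Monoid.CoprodI.of (M := fun o => H o) (i := o) ⟨b o, hb o⟩) = b o := by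
  rw [Monoid.CoprodI.lift_of]
  rfl

/-- **Theorem (Doan–Kim–Lang–Tan).** If `n` is a prime or the square of a prime, then there
exist matrices `g 1, …, g k` in `SL(2, ℤ)` whose lower-left entries equal `n`, with
`|tr (g i)| ≤ n - 2` and `‖g i‖_F < 2n - 1`, such that the image of `Γ₀(n)` in `PSL(2, ℤ)` is
the free product of the cyclic subgroups generated by the images of the `g i` together with the
cyclic subgroup generated by (the image of) `T`. -/
theorem stmt0 (n : ℕ) (hn : Nat.Prime n ∨ ∃ p : ℕ, Nat.Prime p ∧ n = p ^ 2) :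
    ∃ (k : ℕ) (g : Fin k → SL2Z),
      (∀ i, (g i : Matrix (Fin 2) (Fin 2) ℤ) 1 0 = (n : ℤ)) ∧
      (∀ i, |(g i : Matrix (Fin 2) (Fin 2) ℤ) 0 0 + (g i : Matrix (Fin 2) (Fin 2) ℤ) 1 1|
          ≤ (n : ℤ) - 2) ∧
      (∀ i, Real.sqrt ((((g i : Matrix (Fin 2) (Fin 2) ℤ) 0 0 : ℝ)) ^ 2
          + (((g i : Matrix (Fin 2) (Fin 2) ℤ) 0 1 : ℝ)) ^ 2
          + (((g i : Matrix (Fin 2) (Fin 2) ℤ) 1 0 : ℝ)) ^ 2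
          + (((g i : Matrix (Fin 2) (Fin 2) ℤ) 1 1 : ℝ)) ^ 2) < 2 * (n : ℝ) - 1) ∧
      (∀ H : Option (Fin k) → Subgroup PSL2Z,
        H none = Subgroup.zpowers (projPSL ModularGroup.T) →
        (∀ i, H (some i) = Subgroup.zpowers (projPSL (g i))) →
        Function.Injective (Monoid.CoprodI.lift (fun o => (H o).subtype)) ∧
        (Monoid.CoprodI.lift (fun o => (H o).subtype)).range
          = (CongruenceSubgroup.Gamma0 n).map projPSL) := by
  classical
  have hn1 : 1 < n := by
    rcases hn with h | ⟨p, h, rfl⟩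
    · exact h.one_lt
    · exact one_lt_pow₀ h.one_lt (by norm_num)
  have hnil := hnil_of hn
  have : NeZero n := ⟨by omega⟩
  choose gm hg00 hg10 hg11 hg01 hgm using exists_gm (n := n) hn1
  have R1 := pg_R1 hn1 gm hgm
  have R2 := pg_R2 hn1 gm hgm
  obtain ⟨K, hKs, hKf, hKg⟩ := elim_aux (α := (ZMod n)ˣ) sg rho (Ud n) sg_sg
    (fun x hx => rho_mem hx) (fun x hx => rho3 hx) (conn hn1)
  let K0 : Set (ZMod n)ˣ := {x | x ∈ K ∧ (x : ZMod n).val ≤ (sg x : ZMod n).val}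
  have hK0 : ∀ x ∈ K, x ∈ K0 ∨ sg x ∈ K0 := by
    intro x hx
    rcases le_total (x : ZMod n).val (sg x : ZMod n).val with h | h
    · exact Or.inl ⟨hx, h⟩
    · exact Or.inr ⟨hKs x hx, by rw [sg_sg]; exact h⟩
  have hK0' : ∀ x ∈ K0, sg x ∈ K0 → sg x = x := by
    rintro x ⟨_, h1⟩ ⟨_, h2⟩
    rw [sg_sg] at h2
    exact Units.ext (ZMod.val_injective n (le_antisymm h2 h1))
  let e : K0 ≃ Fin (Fintype.card K0) := Fintype.equivFin K0
  refine ⟨Fintype.card K0, fun i => gm (e.symm i), fun i => hg10 _, fun i => ?_, fun i => ?_, ?_⟩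
  · have h1 := val_pos_unit hn1 (e.symm i : (ZMod n)ˣ)
    have h2 := val_pos_unit hn1 (sg (e.symm i : (ZMod n)ˣ))
    rw [hg00, hg11, abs_le]
    constructor <;> linarith [h1.1, h1.2, h2.1, h2.2]
  · have h1 := val_pos_unit hn1 (e.symm i : (ZMod n)ˣ)
    have h2 := val_pos_unit hn1 (sg (e.symm i : (ZMod n)ˣ))
    have h3 := hg01 (e.symm i : (ZMod n)ˣ)
    rw [hg00, hg11]
    exact norm_bound hn1 _ _ _ _ h1 h2 (hg10 _) h3
  intro H hH0 hH1
  let b : Option (Fin (Fintype.card K0)) → PSL2Z := fun o =>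
    o.elim (projPSL ModularGroup.T) (fun i => projPSL (gm (e.symm i)))
  have hH : ∀ o, H o = Subgroup.zpowers (b o) := by
    rintro (_ | i)
    · exact hH0
    · exact hH1 i
  have hb : ∀ o, b o ∈ H o := by
    intro o
    rw [hH o]
    exact Subgroup.mem_zpowers _
  have hbe : ∀ x : K0, b (some (e x)) = projPSL (gm x) := by
    intro x
    simp [b]
  refine core hn1 hnil gm hgm K K0 (fun x hx => hx.1) hK0 hK0' hKf hKg _
    (Monoid.CoprodI.of (M := fun o => H o) (i := none) ⟨b none, hb none⟩)
    (fun x => Monoid.CoprodI.of (M := fun o => H o) (i := some (e x)) ⟨b (some (e x)), hb _⟩)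
    (cop_lift H b hb none) (fun x => (cop_lift H b hb _).trans (hbe x)) ?_ ?_
  · intro x m h
    exact cop_pow H b hb _ m (by rw [hbe]; exact h)
  · intro W h1 h2
    refine cop_gen H b hH hb W ?_
    rintro (_ | i)
    · exact h1
    · obtain ⟨x, rfl⟩ := e.surjective i
      exact h2 x
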